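/- Let H_C ⊆ GL(3, ℝ) be the set of unipotent matrices N(s,t) with rows (1, s, t), (0, 1, s), (0, 0, 1) for s, t ∈ ℝ; H_C is a subgroup, with N(s,t)·N(s′,t′) = N(s+s′, t+t′+ss′). Acting on the unit sphere S² ⊆ ℝ³ by A • v = Av/‖Av‖, the orbits of H_C are exactly: the two points e₁ and −e₁; the two open half-circles that are the connected components of the great circle S² ∩ {v : v₃ = 0} with ±e₁ removed; and the two open hemispheres {v ∈ S² : v₃ > 0} and {v ∈ S² : v₃ < 0}. -/

import Mathlib

/-- The unit sphere `S²` in `ℝ³` (Euclidean norm). -/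
def sphere2 : Set (Fin 3 → ℝ) := {v | ∑ i, v i ^ 2 = 1}

/-- `± eᵢ`: the vector with `ε` in coordinate `i` and `0` elsewhere. -/
def unitVec (i : Fin 3) (ε : ℝ) : Fin 3 → ℝ := fun j => if j = i then ε else 0

/-- The projective action of an (invertible) matrix `A` on the sphere of directions:
`v ↦ A v / ‖A v‖`. -/
noncomputable def projAct (A : Matrix (Fin 3) (Fin 3) ℝ) (v : Fin 3 → ℝ) : Fin 3 → ℝ :=
  (Real.sqrt (∑ i, (A.mulVec v) i ^ 2))⁻¹ • A.mulVec v

/-- The orbit of `v` under a set `H` of matrices acting projectively on the sphere. -/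
noncomputable def sorbit (H : Set (Matrix (Fin 3) (Fin 3) ℝ)) (v : Fin 3 → ℝ) :
    Set (Fin 3 → ℝ) := {w | ∃ A ∈ H, w = projAct A v}

theorem mem_sphere2 (v : Fin 3 → ℝ) : v ∈ sphere2 ↔ v 0 ^ 2 + v 1 ^ 2 + v 2 ^ 2 = 1 := by
  simp [sphere2, Fin.sum_univ_three]

theorem inv_sqrt_smul_mem_sphere2 {u : Fin 3 → ℝ} (hu : 0 < ∑ i, u i ^ 2) :
    (Real.sqrt (∑ i, u i ^ 2))⁻¹ • u ∈ sphere2 := by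
  simp only [sphere2, Set.mem_ofPred_eq, Pi.smul_apply, smul_eq_mul, mul_pow, ← Finset.mul_sum,
    inv_pow, Real.sq_sqrt hu.le]
  exact inv_mul_cancel₀ hu.ne'

/-- Two unit vectors that are positively proportional to the same vector agree. -/
theorem inv_sqrt_smul_eq_of_eq_smul {u w : Fin 3 → ℝ} {c : ℝ} (hw : w ∈ sphere2) (hc : 0 < c)
    (h : w = c • u) : w = (Real.sqrt (∑ i, u i ^ 2))⁻¹ • u := by
  have h1 : c ^ 2 * ∑ i, u i ^ 2 = 1 := by
    have := hw
    simpa [sphere2, h, mul_pow, ← Finset.mul_sum] using this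
  have h2 : ∑ i, u i ^ 2 = c⁻¹ ^ 2 := by
    field_simp
    linarith
  rw [h2, Real.sqrt_sq (inv_pos.mpr hc).le, inv_inv, h]

/-- A unit vector lies in the orbit of `v` under the unipotent group iff it is a positive multiple
of the image of `v` under some group element. -/
theorem mem_sorbit_unipotent {v w : Fin 3 → ℝ} (hv : v ∈ sphere2) :
    w ∈ sorbit {A | ∃ s t : ℝ, A = !![1, s, t; 0, 1, s; 0, 0, 1]} v ↔
      w ∈ sphere2 ∧ ∃ s t c : ℝ, 0 < c ∧ w 0 = c * (v 0 + s * v 1 + t * v 2) ∧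
        w 1 = c * (v 1 + s * v 2) ∧ w 2 = c * v 2 := by
  have hmul (s t : ℝ) : (!![1, s, t; 0, 1, s; 0, 0, 1] : Matrix (Fin 3) (Fin 3) ℝ).mulVec v =
      ![v 0 + s * v 1 + t * v 2, v 1 + s * v 2, v 2] := by
    ext i
    fin_cases i <;> simp [Matrix.mulVec, dotProduct, Fin.sum_univ_three]
  constructor
  · rintro ⟨_, ⟨s, t, rfl⟩, rfl⟩
    have hpos : 0 <
        ∑ i, (!![1, s, t; 0, 1, s; 0, 0, 1] : Matrix (Fin 3) (Fin 3) ℝ).mulVec v i ^ 2 := by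
      refine (Finset.sum_nonneg fun i _ => sq_nonneg _).lt_of_ne' fun h => ?_
      rw [mem_sphere2] at hv
      simp only [hmul, Fin.sum_univ_three, Matrix.cons_val] at h
      have h2 : v 2 = 0 := by
        rw [← sq_eq_zero_iff]
        nlinarith [sq_nonneg (v 0 + s * v 1 + t * v 2), sq_nonneg (v 1 + s * v 2), sq_nonneg (v 2)]
      simp only [h2, mul_zero, add_zero] at h hv
      have h1 : v 1 = 0 := by
        rw [← sq_eq_zero_iff]
        nlinarith [sq_nonneg (v 0 + s * v 1), sq_nonneg (v 1)]
      simp only [h1, mul_zero, add_zero] at h hv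
      linarith
    refine ⟨inv_sqrt_smul_mem_sphere2 hpos, s, t, _, inv_pos.mpr (Real.sqrt_pos.mpr hpos), ?_⟩
    simp [projAct, hmul]
  · rintro ⟨hw, s, t, c, hc, h0, h1, h2⟩
    refine ⟨_, ⟨s, t, rfl⟩, inv_sqrt_smul_eq_of_eq_smul hw hc ?_⟩
    rw [hmul]
    ext i
    fin_cases i <;> simp [h0, h1, h2]

theorem unitVec_mem_sphere2 (i : Fin 3) {ε : ℝ} (hε : ε = 1 ∨ ε = -1) :
    unitVec i ε ∈ sphere2 := by
  rcases hε with rfl | rfl <;> simp [sphere2, unitVec, ite_pow]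

theorem sorbit_unipotent_pole {ε : ℝ} (hε : ε = 1 ∨ ε = -1) :
    sorbit {A | ∃ s t : ℝ, A = !![1, s, t; 0, 1, s; 0, 0, 1]} (unitVec 0 ε) = {unitVec 0 ε} := by
  have hv := unitVec_mem_sphere2 0 hε
  ext w
  rw [mem_sorbit_unipotent hv, Set.mem_singleton_iff]
  constructor
  · rintro ⟨hw, s, t, c, hc, h0, h1, h2⟩
    simp only [unitVec, Fin.isValue, if_true, one_ne_zero, if_false, Fin.reduceEq, mul_zero,
      add_zero] at h0 h1 h2
    rw [mem_sphere2, h0, h1, h2] at hw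
    have hc1 : c = 1 := by rcases hε with rfl | rfl <;> nlinarith
    ext i
    fin_cases i <;> simp [unitVec, h0, h1, h2, hc1]
  · rintro rfl
    exact ⟨hv, 0, 0, 1, one_pos, by simp⟩

theorem sorbit_unipotent_half_circle {ε : ℝ} {v : Fin 3 → ℝ} (hv : v ∈ sphere2) (hv2 : v 2 = 0)
    (hv1 : 0 < ε * v 1) :
    sorbit {A | ∃ s t : ℝ, A = !![1, s, t; 0, 1, s; 0, 0, 1]} v =
      {w ∈ sphere2 | w 2 = 0 ∧ 0 < ε * w 1} := by
  ext w
  rw [mem_sorbit_unipotent hv, Set.mem_ofPred_eq, and_congr_right_iff]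
  refine fun _ => ⟨?_, ?_⟩
  · rintro ⟨s, t, c, hc, -, h1, h2⟩
    refine ⟨by simp [h2, hv2], ?_⟩
    rw [h1, hv2, mul_zero, add_zero, mul_left_comm]
    exact mul_pos hc hv1
  · rintro ⟨h2, h1⟩
    have hv1' : v 1 ≠ 0 := right_ne_zero_of_mul hv1.ne'
    have hw1' : w 1 ≠ 0 := right_ne_zero_of_mul h1.ne'
    have hc : 0 < w 1 / v 1 := by
      rw [← mul_div_mul_left _ _ (left_ne_zero_of_mul h1.ne')]
      exact div_pos h1 hv1
    refine ⟨(w 0 / (w 1 / v 1) - v 0) / v 1, 0, w 1 / v 1, hc, ?_, ?_, by simp [h2, hv2]⟩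
    · field_simp
      ring
    · simp [hv2, hv1']

theorem sorbit_unipotent_hemisphere {ε : ℝ} {v : Fin 3 → ℝ} (hv : v ∈ sphere2)
    (hv2 : 0 < ε * v 2) :
    sorbit {A | ∃ s t : ℝ, A = !![1, s, t; 0, 1, s; 0, 0, 1]} v =
      {w ∈ sphere2 | 0 < ε * w 2} := by
  ext w
  rw [mem_sorbit_unipotent hv, Set.mem_ofPred_eq, and_congr_right_iff]
  refine fun _ => ⟨?_, ?_⟩
  · rintro ⟨s, t, c, hc, -, -, h2⟩
    rw [h2, mul_left_comm]
    exact mul_pos hc hv2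
  · intro h2
    have hv2' : v 2 ≠ 0 := right_ne_zero_of_mul hv2.ne'
    have hw2' : w 2 ≠ 0 := right_ne_zero_of_mul h2.ne'
    have hc : 0 < w 2 / v 2 := by
      rw [← mul_div_mul_left _ _ (left_ne_zero_of_mul h2.ne')]
      exact div_pos h2 hv2
    set c := w 2 / v 2 with hcdef
    have hc' := hc.ne'
    refine ⟨(w 1 / c - v 1) / v 2, (w 0 / c - v 0 - (w 1 / c - v 1) / v 2 * v 1) / v 2, c, hc,
      ?_, ?_, ?_⟩
    · rw [div_mul_cancel₀ _ hv2']
      field_simp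
      ring
    · rw [div_mul_cancel₀ _ hv2']
      field_simp
      ring
    · rw [hcdef, div_mul_cancel₀ _ hv2']

theorem exists_sign_mul_pos {x : ℝ} (hx : x ≠ 0) : ∃ ε : ℝ, (ε = 1 ∨ ε = -1) ∧ 0 < ε * x := by
  rcases hx.lt_or_gt with h | h
  · exact ⟨-1, .inr rfl, by linarith⟩
  · exact ⟨1, .inl rfl, by linarith⟩

theorem sign_mul_unitVec_apply_pos (i : Fin 3) {ε : ℝ} (hε : ε = 1 ∨ ε = -1) :
    0 < ε * unitVec i ε i := by
  rcases hε with rfl | rfl <;> simp [unitVec]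

/-- Case C of Appendix C: `H_C = {N(s,t)}` is a subgroup of unipotent matrices with
`N(s,t)·N(s′,t′) = N(s+s′, t+t′+ss′)`, and its orbits on `S²` are exactly the two points
`±e₁`, the two open half-circles of the great circle `{v₃ = 0}` minus `±e₁`, and the two open
hemispheres `{v₃ > 0}` and `{v₃ < 0}`. -/
theorem stmt13 (N : ℝ → ℝ → Matrix (Fin 3) (Fin 3) ℝ)
    (hN : ∀ s t : ℝ, N s t = !![1, s, t; 0, 1, s; 0, 0, 1])
    (H : Set (Matrix (Fin 3) (Fin 3) ℝ)) (hH : H = {A | ∃ s t : ℝ, A = N s t}) :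
    (∀ s t s' t' : ℝ, N s t * N s' t' = N (s + s') (t + t' + s * s')) ∧
    ({S : Set (Fin 3 → ℝ) | ∃ v ∈ sphere2, S = sorbit H v} =
      {S | ∃ ε : ℝ, (ε = 1 ∨ ε = -1) ∧ S = {unitVec 0 ε}} ∪
      {S | ∃ ε : ℝ, (ε = 1 ∨ ε = -1) ∧
        S = {v ∈ sphere2 | v 2 = 0 ∧ 0 < ε * v 1}} ∪
      {S | ∃ ε : ℝ, (ε = 1 ∨ ε = -1) ∧
        S = {v ∈ sphere2 | 0 < ε * v 2}}) := by
  subst hH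
  simp only [hN]
  constructor
  · intro s t s' t'
    ext i j
    fin_cases i <;> fin_cases j <;> simp [Matrix.mul_apply, Fin.sum_univ_three] <;> ring
  ext S
  simp only [Set.mem_union, Set.mem_ofPred_eq]
  constructor
  · rintro ⟨v, hv, rfl⟩
    by_cases h2 : v 2 = 0
    · by_cases h1 : v 1 = 0
      · have h0 : v 0 = 1 ∨ v 0 = -1 := by
          rw [mem_sphere2, h1, h2] at hv
          exact eq_or_eq_neg_of_sq_eq_sq _ _ (by linarith)
        have hv' : v = unitVec 0 (v 0) := by
          ext i
          fin_cases i <;> simp [unitVec, h1, h2]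
        refine .inl (.inl ⟨v 0, h0, ?_⟩)
        rw [hv']
        exact sorbit_unipotent_pole h0
      · obtain ⟨ε, hε, hpos⟩ := exists_sign_mul_pos h1
        exact .inl (.inr ⟨ε, hε, sorbit_unipotent_half_circle hv h2 hpos⟩)
    · obtain ⟨ε, hε, hpos⟩ := exists_sign_mul_pos h2
      exact .inr ⟨ε, hε, sorbit_unipotent_hemisphere hv hpos⟩
  · rintro ((⟨ε, hε, rfl⟩ | ⟨ε, hε, rfl⟩) | ⟨ε, hε, rfl⟩)
    · exact ⟨_, unitVec_mem_sphere2 0 hε, (sorbit_unipotent_pole hε).symm⟩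
    · exact ⟨_, unitVec_mem_sphere2 1 hε, (sorbit_unipotent_half_circle
        (unitVec_mem_sphere2 1 hε) (by simp [unitVec]) (sign_mul_unitVec_apply_pos 1 hε)).symm⟩
    · exact ⟨_, unitVec_mem_sphere2 2 hε, (sorbit_unipotent_hemisphere
        (unitVec_mem_sphere2 2 hε) (sign_mul_unitVec_apply_pos 2 hε)).symm⟩
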